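/- arXiv:2311.07208 — 2 statements merged into one kernel-verified Lean document; each statement's English description precedes it below -/
import Mathlib

section
/- Let f: [0,1] → [0,1] be a continuous transitive map. Then the set of invariant measures supported on periodic orbits of f is dense in the set of all f-invariant Borel probability measures with the weak* topology. -/
open MeasureTheory Filter Topology
open scoped ENNReal NNReal

section Defs

variable {X : Type*} [MetricSpace X] [MeasurableSpace X] [BorelSpace X]

/-- Kantorovich–Rubinshtein (dual-Lipschitz) distance between two measures:
the supremum of `|∫ f dμ - ∫ f dν|` over bounded `f` with Lipschitz constant at most `1`. -/
noncomputable def krDist (μ ν : Measure X) : ℝ :=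
  sSup { r : ℝ | ∃ f : X → ℝ, LipschitzWith 1 f ∧ (∃ C, ∀ x, |f x| ≤ C) ∧
    r = |∫ x, f x ∂μ - ∫ x, f x ∂ν| }

/-- Empirical measure of the first `n` terms of a sequence (as a plain measure). -/
noncomputable def empMeas (x : ℕ → X) (n : ℕ) : Measure X :=
  (n : ℝ≥0∞)⁻¹ • ∑ i ∈ Finset.range n, Measure.dirac (x i)

/-- Average of the Dirac measures at the first `max n 1` points of a sequence, as a
probability measure.  For `n ≥ 1` this is the `n`-th empirical measure. -/
noncomputable def avgDirac (x : ℕ → X) (n : ℕ) : ProbabilityMeasure X :=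
  ⟨((max n 1 : ℕ) : ℝ≥0∞)⁻¹ • ∑ i ∈ Finset.range (max n 1), Measure.dirac (x i), by
    constructor
    have h : (∑ i ∈ Finset.range (max n 1), Measure.dirac (x i)) Set.univ
        = ((max n 1 : ℕ) : ℝ≥0∞) := by
      simp [Measure.finset_sum_apply]
    rw [Measure.smul_apply, h, smul_eq_mul]
    exact ENNReal.inv_mul_cancel (by simp) (by simp)⟩

/-- The set of weak* limit points of the empirical measures of a sequence. -/
def limitMeasures (x : ℕ → X) : Set (ProbabilityMeasure X) :=
  { μ | ∃ φ : ℕ → ℕ, StrictMono φ ∧ Tendsto (fun k => avgDirac x (φ k)) atTop (𝓝 μ) }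

/-- `x` is a generic point for `μ`: the empirical measures along the orbit of `x`
converge to `μ` in the weak* topology. -/
def genericFor (T : X → X) (x : X) (μ : ProbabilityMeasure X) : Prop :=
  Tendsto (fun n => avgDirac (fun i => T^[i] x) n) atTop (𝓝 μ)

/-- The invariant measure supported on the periodic orbit of `x` of period `p`. -/
noncomputable def periodicOrbitMeasure (T : X → X) (x : X) (p : ℕ) : ProbabilityMeasure X :=
  avgDirac (fun i => T^[i] x) p

/-- The set of invariant measures supported on periodic orbits of points of `K`. -/
def perMeasures (T : X → X) (K : Set X) : Set (ProbabilityMeasure X) :=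
  { μ | ∃ x ∈ K, ∃ p, 0 < p ∧ T^[p] x = x ∧ μ = periodicOrbitMeasure T x p }

/-- The mean orbital pseudo-metric `Ē`. -/
noncomputable def meanOrbitalDist (T : X → X) (x y : X) : ℝ :=
  limsup (fun n => ⨅ σ : Equiv.Perm (Fin n),
    (∑ i : Fin n, dist (T^[(i : ℕ)] x) (T^[((σ i : Fin n) : ℕ)] y)) / n) atTop

/-- `x` is an asymptotic average pseudo-orbit for `T`. -/
def IsAAPO (T : X → X) (x : ℕ → X) : Prop :=
  Tendsto (fun n => (∑ i ∈ Finset.range n, dist (T (x i)) (x (i + 1))) / n) atTop (𝓝 0)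

/-- The point `x` is `K`-closable. -/
def ClosableAt (T : X → X) (K : Set X) (x : X) : Prop :=
  ∀ ε > (0 : ℝ), ∀ N : ℕ, ∃ p q : ℕ, 0 < p ∧ N ≤ p ∧ p ≤ q ∧ (q : ℝ) ≤ (1 + ε) * p ∧
    ∃ y ∈ K, T^[q] y = y ∧ ∀ i < p, dist (T^[i] y) (T^[i] x) < ε

/-- The set `K ⊆ Per(T)` is linkable. -/
def Linkable (T : X → X) (K : Set X) : Prop :=
  ∀ y₁ ∈ K, ∀ y₂ ∈ K, ∀ ε > (0 : ℝ), ∀ lam ∈ Set.Icc (0 : ℝ) 1,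
    ∃ p₁ p₂ q₁ q₂ : ℕ, 0 < p₁ ∧ 0 < p₂ ∧ T^[p₁] y₁ = y₁ ∧ T^[p₂] y₂ = y₂ ∧
      ∃ z ∈ K, T^[q₂] z = z ∧
        lam - ε ≤ (p₁ : ℝ) / (p₁ + p₂) ∧ (p₁ : ℝ) / (p₁ + p₂) ≤ lam + ε ∧
        p₁ ≤ q₁ ∧ (q₁ : ℝ) ≤ (1 + ε) * p₁ ∧ (∀ i < p₁, dist (T^[i] z) (T^[i] y₁) < ε) ∧
        p₂ ≤ q₂ - q₁ ∧ ((q₂ - q₁ : ℕ) : ℝ) ≤ (1 + ε) * p₂ ∧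
        (∀ i < p₂, dist (T^[i + q₁] z) (T^[i] y₂) < ε)

/-- `(X,T)` has the asymptotic orbital average shadowing property. -/
def AOASP (T : X → X) : Prop :=
  ∀ x : ℕ → X, IsAAPO T x → ∃ z : X,
    Tendsto (fun n => ⨅ σ : Equiv.Perm (Fin n),
      (∑ i : Fin n, dist (x (i : ℕ)) (T^[((σ i : Fin n) : ℕ)] z)) / n) atTop (𝓝 0)

end Defs

namespace IntervalDynamics

open Set Function

/-- The forward orbit of `x` enters every nonempty open set at arbitrarily late times. -/
def HasRecurringDenseOrbit {X : Type*} [TopologicalSpace X] (f : X → X) (x : X) : Prop :=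
  ∀ U : Set X, IsOpen U → U.Nonempty → ∀ N : ℕ, ∃ n ≥ N, f^[n] x ∈ U

theorem hasRecurringDenseOrbit_of_dense {X : Type*} [TopologicalSpace X] [T1Space X]
    [∀ x : X, (𝓝[≠] x).NeBot] {f : X → X} {x : X}
    (h : Dense (range fun n : ℕ => f^[n] x)) : HasRecurringDenseOrbit f x := by
  intro U hU hne N
  have hfin : ((fun n : ℕ => f^[n] x) '' Iio N).Finite := (finite_Iio N).image _
  obtain ⟨y, hyU, ⟨n, rfl⟩, hn⟩ := (h.sdiff_finite hfin).inter_open_nonempty U hU hne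
  refine ⟨n, ?_, hyU⟩
  by_contra hlt
  exact hn ⟨n, by simpa using hlt, rfl⟩

section Periodic

variable {f : unitInterval → unitInterval} {x₀ : unitInterval}

theorem lt_iterate_of_no_periodicPts (hf : Continuous f) {a b : unitInterval}
    (h : ∀ p ∈ Ioo a b, p ∉ periodicPts f) {k : ℕ} (hk : 0 < k) {y z : unitInterval}
    (hy : y ∈ Ioo a b) (hz : z ∈ Ioo a b) (hyk : y ≤ f^[k] y) : z < f^[k] z := by
  by_contra hlt
  obtain ⟨p, hp, hpk⟩ := isPreconnected_Ioo.intermediate_value₂ hy hz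
    continuous_id.continuousOn (hf.iterate k).continuousOn hyk (not_lt.mp hlt)
  exact h p hp ⟨k, hk, hpk.symm⟩

theorem iterate_lt_of_no_periodicPts (hf : Continuous f) {a b : unitInterval}
    (h : ∀ p ∈ Ioo a b, p ∉ periodicPts f) {k : ℕ} (hk : 0 < k) {y z : unitInterval}
    (hy : y ∈ Ioo a b) (hz : z ∈ Ioo a b) (hyk : f^[k] y ≤ y) : f^[k] z < z := by
  by_contra hlt
  obtain ⟨p, hp, hpk⟩ := isPreconnected_Ioo.intermediate_value₂ hy hz
    (hf.iterate k).continuousOn continuous_id.continuousOn hyk (not_lt.mp hlt)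
  exact h p hp ⟨k, hk, hpk⟩

theorem dense_periodicPts (hf : Continuous f) (hx₀ : HasRecurringDenseOrbit f x₀) :
    Dense (periodicPts f) := by
  rw [dense_iff_inter_open]
  intro U hU hne
  obtain ⟨a, b, hab, habU⟩ := hU.exists_Ioo_subset hne
  by_contra hcon
  have h : ∀ p ∈ Ioo a b, p ∉ periodicPts f := fun p hp hpp => hcon ⟨p, habU hp, hpp⟩
  obtain ⟨m, ham, hmb⟩ := exists_between hab
  obtain ⟨n₁, -, h₁⟩ := hx₀ _ isOpen_Ioo (nonempty_Ioo.2 ham) 0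
  obtain ⟨n₂, hn₂, h₂⟩ := hx₀ _ isOpen_Ioo (nonempty_Ioo.2 hmb) (n₁ + 1)
  obtain ⟨n₃, hn₃, h₃⟩ := hx₀ _ isOpen_Ioo (nonempty_Ioo.2 ham) (n₂ + 1)
  obtain ⟨i, rfl⟩ := Nat.exists_eq_add_of_le' hn₂
  obtain ⟨j, rfl⟩ := Nat.exists_eq_add_of_le' hn₃
  set z := f^[n₁] x₀
  set w := f^[i + (n₁ + 1)] x₀
  have hz : z ∈ Ioo a b := ⟨h₁.1, h₁.2.trans hmb⟩
  have hw : w ∈ Ioo a b := ⟨ham.trans h₂.1, h₂.2⟩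
  have hzw : f^[i + 1] z = w := by
    simp only [z, w, ← iterate_add_apply]; congr 1; omega
  have hwv : f^[j + 1] w = f^[j + (i + (n₁ + 1) + 1)] x₀ := by
    simp only [w, ← iterate_add_apply]; congr 1; omega
  have hup : ∀ k, z < f^[k * (i + 1) + (i + 1)] z := by
    intro k
    induction k with
    | zero => simpa [hzw] using h₁.2.trans h₂.1
    | succ k ih =>
      have hlt := lt_iterate_of_no_periodicPts hf h (by positivity) hz hw ih.le
      rw [show (k + 1) * (i + 1) + (i + 1) = k * (i + 1) + (i + 1) + (i + 1) by ring,
        iterate_add_apply, hzw]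
      exact (h₁.2.trans h₂.1).trans hlt
  have hdown : ∀ k, f^[k * (j + 1) + (j + 1)] w < w := by
    intro k
    induction k with
    | zero => simpa [hwv] using h₃.2.trans h₂.1
    | succ k ih =>
      have hlt := iterate_lt_of_no_periodicPts hf h (by positivity) hw
        (z := f^[j + 1] w) (hwv ▸ ⟨h₃.1, h₃.2.trans hmb⟩) ih.le
      rw [show (k + 1) * (j + 1) + (j + 1) = k * (j + 1) + (j + 1) + (j + 1) by ring,
        iterate_add_apply]
      exact hlt.trans (hwv ▸ h₃.2.trans h₂.1)
  have h1 := hup j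
  have h2 := hdown i
  have := lt_iterate_of_no_periodicPts hf h (by positivity) hz hw h1.le
  have heq : j * (i + 1) + (i + 1) = i * (j + 1) + (j + 1) := by ring
  rw [heq] at this
  exact lt_asymm this h2

theorem exists_periodic_mem_Ioo_notMem (hf : Continuous f) (hx₀ : HasRecurringDenseOrbit f x₀)
    {S : Set unitInterval} (hS : S.Finite) {a b : unitInterval} (hab : a < b) :
    ∃ p ∈ Ioo a b, p ∉ S ∧ ∃ k, 0 < k ∧ f^[k] p = p := by
  obtain ⟨p, hp, ⟨k, hk, hpk⟩, hpS⟩ :=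
    ((dense_periodicPts hf hx₀).sdiff_finite hS).inter_open_nonempty
    _ isOpen_Ioo (nonempty_Ioo.2 hab)
  exact ⟨p, hp, hpS, k, hk, hpk⟩

theorem iterate_mul_of_iterate_eq {X : Type*} {f : X → X} {p : X} {k : ℕ} (h : f^[k] p = p)
    (j : ℕ) : f^[j * k] p = p := by
  rw [mul_comm, iterate_mul]; exact iterate_fixed h j

theorem finite_range_iterate {X : Type*} {f : X → X} {p : X} {k : ℕ} (hk : 0 < k)
    (h : f^[k] p = p) : (range fun n : ℕ => f^[n] p).Finite := by
  refine ((finite_Iio k).image fun n => f^[n] p).subset ?_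
  rintro _ ⟨n, rfl⟩
  exact ⟨n % k, Nat.mod_lt _ hk, IsPeriodicPt.iterate_mod_apply h n⟩

end Periodic

section Covering

variable {f : unitInterval → unitInterval} {x₀ c : unitInterval}

/-- A set containing a nondegenerate interval around a periodic point `p` has images, all
containing one common point of the orbit of `p`, that come close to any prescribed point and to any
prescribed fixed point. -/
theorem exists_images_near (hf : Continuous f) (hx₀ : HasRecurringDenseOrbit f x₀)
    (hc : f c = c) {L : Set unitInterval} {a b p : unitInterval} (hab : a < b)
    (hL : Ioo a b ⊆ L) (hp : p ∈ L) {k : ℕ} (hk : 0 < k) (hpk : f^[k] p = p)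
    (t : unitInterval) {U V : Set unitInterval} (hU : U ∈ 𝓝 t) (hV : V ∈ 𝓝 c) :
    ∃ i, ∃ u ∈ U, ∃ v ∈ V, ∃ m n, u ∈ f^[m] '' L ∧ f^[i] p ∈ f^[m] '' L ∧
      v ∈ f^[n] '' L ∧ f^[i] p ∈ f^[n] '' L := by
  set W : ℕ → Set unitInterval := fun i => ⋃ j : ℕ, f^[j * k + i] '' L with hW
  have hp' : ∀ i j, f^[i] p ∈ f^[j * k + i] '' L := fun i j =>
    ⟨p, hp, by rw [add_comm, iterate_add_apply, iterate_mul_of_iterate_eq hpk]⟩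
  have hsub : ∀ i l, W (i + l * k) ⊆ W i := by
    intro i l y hy
    obtain ⟨j, hj⟩ := mem_iUnion.1 hy
    refine mem_iUnion.2 ⟨j + l, ?_⟩
    convert hj using 3
    ring
  have hdense : ∀ s : unitInterval, ∃ i, s ∈ closure (W i) := by
    obtain ⟨n₀, -, hn₀⟩ := hx₀ _ isOpen_Ioo (nonempty_Ioo.2 hab) 0
    have hd : Dense (⋃ i : Fin k, W i) := by
      rw [dense_iff_inter_open]
      intro O hO hne
      obtain ⟨n, hn, hnO⟩ := hx₀ O hO hne n₀
      obtain ⟨l, rfl⟩ := Nat.exists_eq_add_of_le' hn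
      refine ⟨_, hnO, mem_iUnion.2 ⟨⟨l % k, Nat.mod_lt _ hk⟩, mem_iUnion.2 ⟨l / k, ?_⟩⟩⟩
      refine ⟨_, hL hn₀, ?_⟩
      rw [Nat.div_add_mod', ← iterate_add_apply]
    intro s
    have hs := hd s
    rw [closure_iUnion_of_finite] at hs
    obtain ⟨i, hi⟩ := mem_iUnion.1 hs
    exact ⟨i, hi⟩
  have hstep : ∀ i, c ∈ closure (W i) → c ∈ closure (W (i + 1)) := by
    intro i hi
    have := image_closure_subset_closure_image hf ⟨c, hi, hc⟩
    refine closure_mono ?_ this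
    rintro _ ⟨y, hy, rfl⟩
    obtain ⟨j, z, hz, rfl⟩ := mem_iUnion.1 hy
    exact mem_iUnion.2 ⟨j, z, hz, by rw [← add_assoc, iterate_succ_apply']⟩
  have hcW : ∀ i, c ∈ closure (W i) := by
    obtain ⟨i₀, hi₀⟩ := hdense c
    intro i
    have hle : i₀ ≤ i + i₀ * k := (Nat.le_mul_of_pos_right i₀ hk).trans (Nat.le_add_left _ _)
    have : c ∈ closure (W (i + i₀ * k)) :=
      Nat.le_induction (m := i₀) (P := fun n _ => c ∈ closure (W n)) hi₀ (fun n _ => hstep n) _ hle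
    exact closure_mono (hsub i i₀) this
  obtain ⟨i, hi⟩ := hdense t
  obtain ⟨u, huU, hu⟩ := mem_closure_iff_nhds.1 hi U hU
  obtain ⟨v, hvV, hv⟩ := mem_closure_iff_nhds.1 (hcW i) V hV
  obtain ⟨m, hm⟩ := mem_iUnion.1 hu
  obtain ⟨n, hn⟩ := mem_iUnion.1 hv
  exact ⟨i, u, huU, v, hvV, _, _, hm, hp' i m, hn, hp' i n⟩

theorem exists_image_mem_nhds (hf : Continuous f) (hx₀ : HasRecurringDenseOrbit f x₀)
    (hc : f c = c) {x : unitInterval} (hx : x ∉ ({0, 1, c} : Set unitInterval))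
    {L : Set unitInterval} (hL : IsPreconnected L) {a b : unitInterval} (hab : a < b)
    (ha : a ∈ L) (hb : b ∈ L) : ∃ m, f^[m] '' L ∈ 𝓝 x := by
  simp only [mem_insert_iff, mem_singleton_iff, not_or] at hx
  obtain ⟨hx0, hx1, hxc⟩ := hx
  have hIoo : Ioo a b ⊆ L := Ioo_subset_Icc_self.trans (hL.Icc_subset ha hb)
  obtain ⟨p, hp, hpx, k, hk, hpk⟩ : ∃ p ∈ Ioo a b, (∀ i, f^[i] p ≠ x) ∧
      ∃ k, 0 < k ∧ f^[k] p = p := by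
    by_cases hper : x ∈ periodicPts f
    · obtain ⟨K, hK, hxK⟩ := hper
      obtain ⟨p, hp, hpS, k, hk, hpk⟩ :=
        exists_periodic_mem_Ioo_notMem hf hx₀ (finite_range_iterate hK hxK) hab
      refine ⟨p, hp, fun i hi => hpS ⟨i * k - i, ?_⟩, k, hk, hpk⟩
      simp only [← hi, ← iterate_add_apply]
      rw [Nat.sub_add_cancel (Nat.le_mul_of_pos_right i hk), iterate_mul_of_iterate_eq hpk]
    · obtain ⟨p, hp, -, k, hk, hpk⟩ := exists_periodic_mem_Ioo_notMem hf hx₀ finite_empty hab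
      refine ⟨p, hp, fun i hi => hper ?_, k, hk, hpk⟩
      rw [← hi]
      exact ⟨k, hk, (IsPeriodicPt.apply_iterate (show IsPeriodicPt f k p from hpk) i)⟩
  have himage : ∀ m, ∀ u ∈ f^[m] '' L, ∀ v ∈ f^[m] '' L, u < x → x < v → f^[m] '' L ∈ 𝓝 x :=
    fun m u hu v hv hux hxv => mem_of_superset (Icc_mem_nhds hux hxv)
      ((hL.image _ (hf.iterate m).continuousOn).Icc_subset hu hv)
  rcases lt_or_gt_of_ne hxc with hxc | hxc
  · obtain ⟨i, u, hu, v, hv, m, n, h1, h2, h3, h4⟩ := exists_images_near hf hx₀ hc hab hIoo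
      (hIoo hp) hk hpk 0 (Iio_mem_nhds (unitInterval.pos_iff_ne_zero.2 hx0)) (Ioi_mem_nhds hxc)
    rcases lt_or_gt_of_ne (hpx i) with h | h
    · exact ⟨n, himage n _ h4 _ h3 h hv⟩
    · exact ⟨m, himage m _ h1 _ h2 hu h⟩
  · obtain ⟨i, u, hu, v, hv, m, n, h1, h2, h3, h4⟩ := exists_images_near hf hx₀ hc hab hIoo
      (hIoo hp) hk hpk 1 (Ioi_mem_nhds (unitInterval.lt_one_iff_ne_one.2 hx1)) (Iio_mem_nhds hxc)
    rcases lt_or_gt_of_ne (hpx i) with h | h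
    · exact ⟨m, himage m _ h2 _ h1 h hu⟩
    · exact ⟨n, himage n _ h3 _ h4 hv h⟩

theorem exists_dist_iterate_ge (hf : Continuous f) (hx₀ : HasRecurringDenseOrbit f x₀)
    (hc : f c = c) {a b : unitInterval} (hab : a < b) (x : unitInterval) :
    ∃ m, ∃ y ∈ Icc a b, 1 / 10 ≤ dist (f^[m] y) (f^[m] x) := by
  obtain ⟨p, hp, -, k, hk, hpk⟩ := exists_periodic_mem_Ioo_notMem hf hx₀ finite_empty hab
  obtain ⟨t, ht⟩ : ∃ t : unitInterval, 1 / 2 ≤ dist t c := by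
    rcases le_total (c : ℝ) (1 / 2) with h | h
    · exact ⟨1, by rw [Subtype.dist_eq, Real.dist_eq]
                   exact le_trans (by simp; linarith) (le_abs_self _)⟩
    · exact ⟨0, by rw [Subtype.dist_eq, Real.dist_eq]
                   exact le_trans (by simp; linarith) (neg_le_abs _)⟩
  obtain ⟨i, u, hu, v, hv, m, n, ⟨u', hu', rfl⟩, ⟨p', hp', hpu⟩, ⟨v', hv', rfl⟩, ⟨q', hq', hqv⟩⟩ :=
    exists_images_near hf hx₀ hc hab Ioo_subset_Icc_self (Ioo_subset_Icc_self hp) hk hpk t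
      (Metric.ball_mem_nhds t (show (0 : ℝ) < 1 / 20 by norm_num))
      (Metric.ball_mem_nhds c (show (0 : ℝ) < 1 / 20 by norm_num))
  rw [Metric.mem_ball] at hu hv
  by_contra! hcon
  have e1 := hcon m u' hu'
  have e2 := hcon m p' hp'
  have e3 := hcon n v' hv'
  have e4 := hcon n q' hq'
  rw [hpu] at e2
  rw [hqv] at e4
  have := dist_triangle t (f^[m] u') c
  have := dist_triangle (f^[m] u') (f^[n] v') c
  have := dist_triangle (f^[m] u') (f^[i] p) (f^[n] v')
  have := dist_triangle_right (f^[m] u') (f^[i] p) (f^[m] x)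
  have := dist_triangle_right (f^[n] v') (f^[i] p) (f^[n] x)
  rw [dist_comm] at hu
  rw [dist_comm (f^[i] p)] at *
  linarith

end Covering

section Shadowing

variable {f : unitInterval → unitInterval} {x₀ c : unitInterval}

theorem exists_uniform_cover_Icc (hf : Continuous f) (hx₀ : HasRecurringDenseOrbit f x₀)
    (hc : f c = c) {x : unitInterval} (hx : x ∉ ({0, 1, c} : Set unitInterval))
    {a b : unitInterval} (hab : a < b) :
    ∃ M : ℕ, ∃ U ∈ 𝓝 x, ∀ j : ℕ, ∃ m, j ≤ m ∧ m ≤ j + M ∧ U ⊆ f^[m] '' Icc a b := by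
  obtain ⟨p, hp, -, k, hk, hpk⟩ := exists_periodic_mem_Ioo_notMem hf hx₀ finite_empty hab
  obtain ⟨q, hq, hqp, l, hl, hql⟩ :=
    exists_periodic_mem_Ioo_notMem hf hx₀ (finite_singleton p) hab
  have hpK : IsPeriodicPt f (k * l) p := by
    rw [mul_comm]; exact iterate_mul_of_iterate_eq hpk l
  have hqK : IsPeriodicPt f (k * l) q := iterate_mul_of_iterate_eq hql k
  have hK : 0 < k * l := Nat.mul_pos hk hl
  have hne : ∀ j, f^[j] p ≠ f^[j] q := by
    intro j hj
    have := congrArg f^[j * (k * l) - j] hj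
    rw [← iterate_add_apply, ← iterate_add_apply,
      Nat.sub_add_cancel (Nat.le_mul_of_pos_right j hK), iterate_mul_of_iterate_eq hpK,
      iterate_mul_of_iterate_eq hqK] at this
    exact hqp this.symm
  have hcov : ∀ j, ∃ m, f^[m] '' uIcc (f^[j] p) (f^[j] q) ∈ 𝓝 x := fun j =>
    exists_image_mem_nhds hf hx₀ hc hx isPreconnected_Icc
      (min_lt_max.2 (hne j)) (left_mem_Icc.2 min_le_max) (right_mem_Icc.2 min_le_max)
  choose m hm using hcov
  refine ⟨(Finset.range (k * l)).sup m,
    ⋂ j ∈ Finset.range (k * l), f^[m j] '' uIcc (f^[j] p) (f^[j] q),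
    (Filter.biInter_finset_mem _).2 fun j _ => hm j, fun j => ?_⟩
  have hj : j % (k * l) ∈ Finset.range (k * l) := Finset.mem_range.2 (Nat.mod_lt _ hK)
  refine ⟨j + m (j % (k * l)), Nat.le_add_right _ _,
    Nat.add_le_add_left (Finset.le_sup (f := m) hj) _, ?_⟩
  refine (biInter_subset_of_mem hj).trans ?_
  rw [hpK.iterate_mod_apply, hqK.iterate_mod_apply, add_comm, iterate_add, image_comp]
  refine image_mono ?_
  exact (isPreconnected_Icc.image _ (hf.iterate j).continuousOn).ordConnected.uIcc_subset
    (mem_image_of_mem _ (Ioo_subset_Icc_self hp)) (mem_image_of_mem _ (Ioo_subset_Icc_self hq))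

theorem exists_uniform_cover (hf : Continuous f) (hx₀ : HasRecurringDenseOrbit f x₀)
    (hc : f c = c) {x : unitInterval} (hx : x ∉ ({0, 1, c} : Set unitInterval))
    {ε : ℝ} (hε : 0 < ε) :
    ∃ M : ℕ, ∃ U ∈ 𝓝 x, ∀ S : Set unitInterval, IsPreconnected S → ∀ y ∈ S, ∀ z ∈ S,
      ε ≤ dist y z → ∀ j : ℕ, ∃ m, j ≤ m ∧ m ≤ j + M ∧ U ⊆ f^[m] '' S := by
  have hcpt : IsCompact {w : unitInterval × unitInterval | ε ≤ dist w.1 w.2} :=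
    (isClosed_le continuous_const continuous_dist).isCompact
  suffices h : ∃ M : ℕ, ∃ U ∈ 𝓝 x, ∀ w ∈ {w : unitInterval × unitInterval | ε ≤ dist w.1 w.2},
      ∀ S : Set unitInterval, IsPreconnected S → w.1 ∈ S → w.2 ∈ S →
      ∀ j : ℕ, ∃ m, j ≤ m ∧ m ≤ j + M ∧ U ⊆ f^[m] '' S by
    obtain ⟨M, U, hU, h⟩ := h
    exact ⟨M, U, hU, fun S hS y hy z hz hyz => h (y, z) hyz S hS hy hz⟩
  refine hcpt.induction_on (p := fun A => ∃ M : ℕ, ∃ U ∈ 𝓝 x, ∀ w ∈ A,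
      ∀ S : Set unitInterval, IsPreconnected S → w.1 ∈ S → w.2 ∈ S →
      ∀ j : ℕ, ∃ m, j ≤ m ∧ m ≤ j + M ∧ U ⊆ f^[m] '' S) ?_ ?_ ?_ ?_
  · exact ⟨0, univ, univ_mem, by simp⟩
  · rintro s t hst ⟨M, U, hU, h⟩
    exact ⟨M, U, hU, fun w hw => h w (hst hw)⟩
  · rintro s t ⟨M, U, hU, h⟩ ⟨M', U', hU', h'⟩
    refine ⟨M + M', U ∩ U', inter_mem hU hU', ?_⟩
    rintro w (hw | hw) S hS h1 h2 j
    · obtain ⟨m, hm, hm', hs⟩ := h w hw S hS h1 h2 j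
      exact ⟨m, hm, by omega, inter_subset_left.trans hs⟩
    · obtain ⟨m, hm, hm', hs⟩ := h' w hw S hS h1 h2 j
      exact ⟨m, hm, by omega, inter_subset_right.trans hs⟩
  · rintro ⟨y, z⟩ hyz
    have hne : y ≠ z := by
      rintro rfl
      simp only [mem_ofPred_eq, dist_self] at hyz
      linarith
    obtain ⟨a, hya, haz⟩ := exists_between (min_lt_max.2 hne)
    obtain ⟨b, hab, hbz⟩ := exists_between haz
    obtain ⟨M, U, hU, h⟩ := exists_uniform_cover_Icc hf hx₀ hc hx hab
    refine ⟨{w | min w.1 w.2 < a ∧ b < max w.1 w.2}, mem_nhdsWithin_of_mem_nhds ?_, M, U, hU, ?_⟩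
    · exact ((isOpen_lt (by fun_prop) continuous_const).inter
        (isOpen_lt continuous_const (by fun_prop))).mem_nhds ⟨hya, hbz⟩
    · rintro w ⟨hw1, hw2⟩ S hS h1 h2 j
      obtain ⟨m, hm, hm', hs⟩ := h j
      refine ⟨m, hm, hm', hs.trans (image_mono ?_)⟩
      exact (Icc_subset_Icc hw1.le hw2.le).trans (hS.ordConnected.uIcc_subset h1 h2)

/-- Near a point `x₁` outside `{0, 1, c}` there are intervals that shadow `x₁` for any prescribed
long time `n` and then cover a fixed neighbourhood of `x₂` after a bounded additional time. -/
theorem exists_shadowing_Icc (hf : Continuous f) (hx₀ : HasRecurringDenseOrbit f x₀)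
    (hc : f c = c) {x₁ x₂ : unitInterval} (hx₁ : x₁ ∉ ({0, 1, c} : Set unitInterval))
    (hx₂ : x₂ ∉ ({0, 1, c} : Set unitInterval)) {ε : ℝ} (hε : 0 < ε) (hε' : ε ≤ 1 / 10) :
    ∃ M : ℕ, ∃ U₂ ∈ 𝓝 x₂, ∀ U₁ ∈ 𝓝 x₁, ∃ N : ℕ, ∀ n ≥ N, ∃ a b : unitInterval, a ≤ b ∧
      Icc a b ⊆ U₁ ∧ (∀ y ∈ Icc a b, ∀ i < n, dist (f^[i] y) (f^[i] x₁) ≤ ε) ∧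
      ∃ m, n ≤ m ∧ m ≤ n + M ∧ U₂ ⊆ f^[m] '' Icc a b := by
  obtain ⟨M, U₂, hU₂, hcov⟩ := exists_uniform_cover hf hx₀ hc hx₂ hε
  refine ⟨M, U₂, hU₂, fun U₁ hU₁ => ?_⟩
  simp only [mem_insert_iff, mem_singleton_iff, not_or] at hx₁
  obtain ⟨b', hb', hbU'⟩ := exists_Ico_subset_of_mem_nhds hU₁
    ⟨1, unitInterval.lt_one_iff_ne_one.2 hx₁.2.1⟩
  obtain ⟨b, hb, hbb'⟩ := exists_between hb'
  have hbU : Icc x₁ b ⊆ U₁ := (Icc_subset_Ico_right hbb').trans hbU'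
  obtain ⟨i₀, t, ht, hti⟩ := exists_dist_iterate_ge hf hx₀ hc hb x₁
  refine ⟨i₀ + 1, fun n hn => ?_⟩
  have hclosed : IsClosed {t | ∃ i ∈ Iio n, ε ≤ dist (f^[i] t) (f^[i] x₁)} := by
    have : {t | ∃ i ∈ Iio n, ε ≤ dist (f^[i] t) (f^[i] x₁)} =
        ⋃ i ∈ Iio n, {t | ε ≤ dist (f^[i] t) (f^[i] x₁)} := by ext; simp
    rw [this]
    exact (finite_Iio n).isClosed_biUnion fun i _ =>
      isClosed_le continuous_const ((hf.iterate i).dist continuous_const)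
  obtain ⟨h, ⟨hmem, i, hin, hih⟩, hleast⟩ := (isCompact_Icc.inter_right hclosed).exists_isLeast
    ⟨t, ht, i₀, hn, hε'.trans hti⟩
  have hne : x₁ ≠ h := by
    rintro rfl
    rw [dist_self] at hih
    linarith
  have hlt : ∀ y ∈ Ico x₁ h, ∀ i < n, dist (f^[i] y) (f^[i] x₁) ≤ ε := by
    intro y hy i hi
    by_contra! hcon
    exact hy.2.not_ge (hleast ⟨⟨hy.1, hy.2.le.trans hmem.2⟩, i, hi, hcon.le⟩)
  refine ⟨x₁, h, hmem.1, (Icc_subset_Icc_right hmem.2).trans hbU, ?_, ?_⟩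
  · intro y hy i hi
    rw [← closure_Ico hne] at hy
    exact closure_minimal (fun y hy => hlt y hy i hi)
      (isClosed_le ((hf.iterate i).dist continuous_const) continuous_const) hy
  · obtain ⟨m, hm, hm', hs⟩ := hcov (f^[i] '' Icc x₁ h)
      (isPreconnected_Icc.image _ (hf.iterate i).continuousOn)
      _ (mem_image_of_mem _ (right_mem_Icc.2 hmem.1))
      _ (mem_image_of_mem _ (left_mem_Icc.2 hmem.1)) hih (n - i)
    rw [← image_comp, ← iterate_add] at hs
    have hin : i < n := hin
    exact ⟨m + i, by omega, by omega, hs⟩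

theorem eq_left_of_dist_le {s t w p : unitInterval} (hw : w ∈ uIcc s t) (hp : p ∈ uIcc w t)
    (h : dist s t ≤ dist p t) : w = s := by
  rw [mem_uIcc] at hw hp
  rw [Subtype.dist_eq, Subtype.dist_eq, Real.dist_eq, Real.dist_eq] at h
  simp only [← Subtype.coe_le_coe] at hw hp
  apply Subtype.ext
  rcases abs_cases ((s : ℝ) - t) with h1 | h1 <;> rcases abs_cases ((p : ℝ) - t) with h2 | h2 <;>
    rcases hw with hw | hw <;> rcases hp with hp | hp <;> linarith

/-- If `g` maps an interval over `Icc u v`, some subinterval is mapped onto exactly `Icc u v`. -/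
theorem exists_Icc_image_eq {g : unitInterval → unitInterval} (hg : Continuous g)
    {a b u v : unitInterval} (huv : u ≤ v) (h : Icc u v ⊆ g '' Icc a b) :
    ∃ s t, s ≤ t ∧ Icc s t ⊆ Icc a b ∧ g '' Icc s t = Icc u v := by
  obtain ⟨s₀, hs₀, hs₀u⟩ := h (left_mem_Icc.2 huv)
  obtain ⟨t₀, ht₀, ht₀v⟩ := h (right_mem_Icc.2 huv)
  have hcpt : IsCompact ((Icc a b ×ˢ Icc a b) ∩ {w : unitInterval × unitInterval |
      g w.1 = u ∧ g w.2 = v}) :=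
    (isCompact_Icc.prod isCompact_Icc).inter_right
      ((isClosed_eq (by fun_prop) continuous_const).inter
        (isClosed_eq (by fun_prop) continuous_const))
  obtain ⟨⟨s, t⟩, ⟨⟨hs, ht⟩, hsu, htv⟩, hmin⟩ := hcpt.exists_isMinOn
    ⟨(s₀, t₀), ⟨hs₀, ht₀⟩, hs₀u, ht₀v⟩ (continuous_dist.continuousOn)
  simp only at hs ht hsu htv
  have hsub : uIcc s t ⊆ Icc a b := ordConnected_Icc.uIcc_subset hs ht
  have hcloser : ∀ p ∈ uIcc s t, ∀ q ∈ uIcc s t, g p = u → g q = v → dist s t ≤ dist p q :=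
    fun p hp q hq hpu hqv => hmin (show (p, q) ∈ _ from ⟨⟨hsub hp, hsub hq⟩, hpu, hqv⟩)
  refine ⟨min s t, max s t, min_le_max, hsub, ?_⟩
  change g '' uIcc s t = _
  refine Subset.antisymm ?_ ?_
  · rintro _ ⟨w, hw, rfl⟩
    constructor
    · by_contra! hlt
      obtain ⟨p, hp, hpu⟩ := isPreconnected_uIcc.intermediate_value
        (left_mem_uIcc (a := w) (b := t)) right_mem_uIcc hg.continuousOn ⟨hlt.le, htv ▸ huv⟩
      have hle := hcloser p (uIcc_subset_uIcc_right hw hp) t right_mem_uIcc hpu htv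
      rw [eq_left_of_dist_le hw hp hle, hsu] at hlt
      exact lt_irrefl _ hlt
    · by_contra! hlt
      obtain ⟨p, hp, hpv⟩ := isPreconnected_uIcc.intermediate_value
        (right_mem_uIcc (a := w) (b := s)) left_mem_uIcc hg.continuousOn ⟨hsu ▸ huv, hlt.le⟩
      have hw' := hw
      rw [uIcc_comm] at hw'
      have hp' := uIcc_subset_uIcc_right hw' hp
      rw [uIcc_comm] at hp'
      have hle := hcloser s left_mem_uIcc p hp' hsu hpv
      rw [dist_comm s t, dist_comm s p] at hle
      rw [eq_left_of_dist_le hw' hp hle, htv] at hlt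
      exact lt_irrefl _ hlt
  · rw [← hsu, ← htv]
    exact isPreconnected_uIcc.intermediate_value left_mem_uIcc right_mem_uIcc hg.continuousOn

theorem exists_mem_Icc_isFixedPt {g : unitInterval → unitInterval} (hg : Continuous g)
    {a b : unitInterval} (hab : a ≤ b) (h : Icc a b ⊆ g '' Icc a b) :
    ∃ y ∈ Icc a b, g y = y := by
  obtain ⟨u, hu, hua⟩ := h (left_mem_Icc.2 hab)
  obtain ⟨v, hv, hvb⟩ := h (right_mem_Icc.2 hab)
  exact isPreconnected_Icc.intermediate_value₂ hu hv hg.continuousOn continuous_id.continuousOn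
    (hua ▸ hu.1) (hvb ▸ hv.2)

theorem exists_periodic_linking (hf : Continuous f) (hx₀ : HasRecurringDenseOrbit f x₀)
    (hc : f c = c) {x₁ x₂ : unitInterval} (hx₁ : x₁ ∉ ({0, 1, c} : Set unitInterval))
    (hx₂ : x₂ ∉ ({0, 1, c} : Set unitInterval)) {ε : ℝ} (hε : 0 < ε) :
    ∃ M N : ℕ, ∀ n ≥ N, ∃ y : unitInterval, ∃ m₁ m₂ : ℕ, n ≤ m₁ ∧ m₁ ≤ n + M ∧
      n ≤ m₂ ∧ m₂ ≤ n + M ∧ f^[m₁ + m₂] y = y ∧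
      (∀ i < n, dist (f^[i] y) (f^[i] x₁) ≤ ε) ∧
      ∀ i < n, dist (f^[i] (f^[m₁] y)) (f^[i] x₂) ≤ ε := by
  wlog hε' : ε ≤ 1 / 10 generalizing ε
  · obtain ⟨M, N, h⟩ := this (ε := 1 / 10) (by norm_num) le_rfl
    refine ⟨M, N, fun n hn => ?_⟩
    obtain ⟨y, m₁, m₂, h1, h2, h3, h4, hy, hy₁, hy₂⟩ := h n hn
    exact ⟨y, m₁, m₂, h1, h2, h3, h4, hy, fun i hi => (hy₁ i hi).trans (not_le.1 hε').le,
      fun i hi => (hy₂ i hi).trans (not_le.1 hε').le⟩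
  obtain ⟨M₁, U₂, hU₂, h₁⟩ := exists_shadowing_Icc hf hx₀ hc hx₁ hx₂ hε hε'
  obtain ⟨M₂, U₁, hU₁, h₂⟩ := exists_shadowing_Icc hf hx₀ hc hx₂ hx₁ hε hε'
  obtain ⟨N₁, h₁⟩ := h₁ U₁ hU₁
  obtain ⟨N₂, h₂⟩ := h₂ U₂ hU₂
  refine ⟨M₁ + M₂, N₁ + N₂, fun n hn => ?_⟩
  obtain ⟨a₁, b₁, hab₁, hJ₁, hs₁, m₁, hm₁, hm₁', hc₁⟩ := h₁ n (by omega)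
  obtain ⟨a₂, b₂, hab₂, hJ₂, hs₂, m₂, hm₂, hm₂', hc₂⟩ := h₂ n (by omega)
  obtain ⟨s, t, hst, hsub, himg⟩ := exists_Icc_image_eq (hf.iterate m₁) hab₂ (hJ₂.trans hc₁)
  obtain ⟨y, hy, hfix⟩ := exists_mem_Icc_isFixedPt (hf.iterate (m₂ + m₁)) hst (by
    rw [iterate_add, image_comp, himg]
    exact hsub.trans (hJ₁.trans hc₂))
  refine ⟨y, m₁, m₂, hm₁, by omega, hm₂, by omega, add_comm m₁ m₂ ▸ hfix,
    fun i hi => hs₁ y (hsub hy) i hi, fun i hi => hs₂ _ ?_ i hi⟩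
  rw [← himg]
  exact mem_image_of_mem _ hy

end Shadowing

section Escaping

theorem exists_pos_forall_lt_of_finite {α : Type*} {S : Set α} (hS : S.Finite) {g : α → ℝ}
    (hg : ∀ a ∈ S, 0 < g a) : ∃ d > 0, ∀ a ∈ S, d < g a := by
  have h : ∀ᶠ d : ℝ in 𝓝[>] 0, ∀ a ∈ S, d < g a :=
    (Filter.eventually_all_finite hS).2 fun a ha =>
      mem_nhdsWithin_of_mem_nhds (Iio_mem_nhds (hg a ha))
  obtain ⟨d, hd, hd0⟩ := (h.and self_mem_nhdsWithin).exists
  exact ⟨d, hd0, hd⟩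

variable {X : Type*} [MetricSpace X] [CompactSpace X] {f : X → X} {x₀ : X}

/-- If the open set `V` contains the orbit of `y` and some open set avoids `V`, then some point
outside `V` has its entire forward orbit (after time zero) in the closed set `K ⊇ V`. -/
theorem exists_notMem_forall_iterate_mem (hf : Continuous f)
    (hx₀ : HasRecurringDenseOrbit f x₀) {V K W : Set X} (hV : IsOpen V) (hK : IsClosed K)
    (hVK : V ⊆ K) (hW : IsOpen W) (hWne : W.Nonempty) (hWV : Disjoint W V) {y : X}
    (hy : ∀ i, f^[i] y ∈ V) : ∃ z ∉ V, ∀ i, 0 < i → f^[i] z ∈ K := by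
  classical
  have key : ∀ n, ∃ z ∉ V, ∀ i, 0 < i → i ≤ n → f^[i] z ∈ V := by
    intro n
    obtain ⟨a, -, ha⟩ := hx₀ W hW hWne 0
    have hO : IsOpen (⋂ i ∈ Finset.range (n + 1), f^[i] ⁻¹' V) :=
      isOpen_biInter_finset fun i _ => hV.preimage (hf.iterate i)
    obtain ⟨b, hab, hb⟩ := hx₀ _ hO ⟨y, by simp [hy]⟩ a
    have hb : ∀ i ≤ n, f^[i] (f^[b] x₀) ∈ V := by
      intro i hi
      simp only [mem_iInter] at hb
      exact hb i (Finset.mem_range.2 (by omega))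
    set l := Nat.findGreatest (fun l => f^[l] x₀ ∉ V) b with hl
    have hlV : f^[l] x₀ ∉ V :=
      Nat.findGreatest_spec (P := fun l => f^[l] x₀ ∉ V) hab (hWV.notMem_of_mem_left ha)
    have hlb : l ≤ b := Nat.findGreatest_le b
    refine ⟨f^[l] x₀, hlV, fun i hi hin => ?_⟩
    rw [← iterate_add_apply]
    by_cases hle : i + l ≤ b
    · exact not_not.1 (Nat.findGreatest_is_greatest (P := fun l => f^[l] x₀ ∉ V)
        (show l < i + l by omega) hle)
    · have := hb (i + l - b) (by omega)
      rwa [← iterate_add_apply, Nat.sub_add_cancel (by omega)] at this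
  have hcl : ∀ n, IsClosed (Vᶜ ∩ ⋂ i ∈ Ioc 0 n, f^[i] ⁻¹' K) := fun n =>
    hV.isClosed_compl.inter (isClosed_biInter fun i _ => hK.preimage (hf.iterate i))
  obtain ⟨z, hz⟩ := IsCompact.nonempty_iInter_of_sequence_nonempty_isCompact_isClosed
    (fun n => Vᶜ ∩ ⋂ i ∈ Ioc 0 n, f^[i] ⁻¹' K)
    (fun n => inter_subset_inter_right _
      (biInter_subset_biInter_left (Ioc_subset_Ioc_right n.le_succ)))
    (fun n => by
      obtain ⟨z, hz, hzi⟩ := key n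
      exact ⟨z, hz, mem_iInter₂.2 fun i hi => hVK (hzi i hi.1 hi.2)⟩)
    (hcl 0).isCompact hcl
  rw [mem_iInter] at hz
  exact ⟨z, (hz 0).1, fun i hi => mem_iInter₂.1 (hz i).2 i ⟨hi, le_rfl⟩⟩

/-- Every periodic orbit is eventually shadowed by the orbit of a point outside a prescribed
finite set. -/
theorem exists_notMem_shadowing [∀ x : X, (𝓝[≠] x).NeBot] (hf : Continuous f)
    (hx₀ : HasRecurringDenseOrbit f x₀) {B : Set X} (hB : B.Finite) {y : X} {p : ℕ} (hp : 0 < p)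
    (hy : f^[p] y = y) {r : ℝ} (hr : 0 < r) :
    ∃ w ∉ B, ∃ s, ∀ i, dist (f^[i] (f^[s] w)) (f^[i] y) ≤ r := by
  by_cases hyB : ∃ j, f^[j] y ∉ B
  · obtain ⟨j, hj⟩ := hyB
    refine ⟨_, hj, j * p - j, fun i => ?_⟩
    rw [← iterate_add_apply f _ j, Nat.sub_add_cancel (Nat.le_mul_of_pos_right j hp),
      iterate_mul_of_iterate_eq hy, dist_self]
    exact hr.le
  push Not at hyB
  set A : Set X := {b | (∀ i, f^[i] b ∈ B) ∧ ∃ i j, f^[i] b = f^[j] y} with hA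
  have hAB : A ⊆ B := fun b hb => hb.1 0
  have hAfin : A.Finite := hB.subset hAB
  have hyA : ∀ i, f^[i] y ∈ A := fun i =>
    ⟨fun j => by rw [← iterate_add_apply]; exact hyB _, 0, i, rfl⟩
  obtain ⟨σ, hσ, hsep⟩ : ∃ σ > 0, ∀ b ∈ B, ∀ b' ∈ B, dist b b' < σ → b = b' := by
    obtain ⟨σ, hσ, h⟩ := exists_pos_forall_lt_of_finite hB.offDiag (g := fun w => dist w.1 w.2)
      fun w hw => dist_pos.2 hw.2.2
    exact ⟨σ, hσ, fun b hb b' hb' hlt => by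
      by_contra hne
      exact (h (b, b') ⟨hb, hb', hne⟩).not_gt hlt⟩
  obtain ⟨ρ, hρ, huc⟩ := Metric.uniformContinuous_iff.1
    (CompactSpace.uniformContinuous_of_continuous hf) (σ / 2) (by positivity)
  obtain ⟨q, hq⟩ : ∃ q, q ∉ A := by
    have : Infinite X := infinite_univ_iff.1 (infinite_of_mem_nhds y univ_mem)
    exact hAfin.exists_notMem
  obtain ⟨d, hd, hdq⟩ := exists_pos_forall_lt_of_finite hAfin (g := fun b => dist q b)
    fun b hb => dist_pos.2 fun h => hq (h ▸ hb)
  obtain ⟨r', hr', hrr, hrρ, hrσ, hrd⟩ :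
      ∃ r' > 0, r' ≤ r ∧ r' < ρ ∧ r' < σ / 2 ∧ r' ≤ d := by
    refine ⟨min (min r d) (min (ρ / 2) (σ / 4)), by positivity, ?_, ?_, ?_, ?_⟩
    · exact (min_le_left _ _).trans (min_le_left _ _)
    · exact ((min_le_right _ _).trans (min_le_left _ _)).trans_lt (by linarith)
    · exact ((min_le_right _ _).trans (min_le_right _ _)).trans_lt (by linarith)
    · exact (min_le_left _ _).trans (min_le_right _ _)
  obtain ⟨z, hzV, hzK⟩ := exists_notMem_forall_iterate_mem hf hx₀
    (V := ⋃ b ∈ A, Metric.ball b r') (K := ⋃ b ∈ A, Metric.closedBall b r')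
    (W := (⋃ b ∈ A, Metric.closedBall b r')ᶜ)
    (isOpen_biUnion fun _ _ => Metric.isOpen_ball)
    (hAfin.isClosed_biUnion fun _ _ => Metric.isClosed_closedBall)
    (iUnion₂_mono fun _ _ => Metric.ball_subset_closedBall)
    (hAfin.isClosed_biUnion fun _ _ => Metric.isClosed_closedBall).isOpen_compl
    ⟨q, by
      simp only [mem_compl_iff, mem_iUnion, Metric.mem_closedBall, not_exists, not_le]
      exact fun b hb => hrd.trans_lt (hdq b hb)⟩
    (disjoint_compl_left_iff_subset.2 (iUnion₂_mono fun _ _ => Metric.ball_subset_closedBall))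
    (fun i => mem_biUnion (hyA i) (Metric.mem_ball_self hr'))
  have hb : ∀ i, ∃ b ∈ A, dist (f^[i + 1] z) b ≤ r' := fun i => by
    simpa using hzK (i + 1) i.succ_pos
  choose b hbA hbz using hb
  have hfA : ∀ a ∈ A, f a ∈ A := by
    rintro a ⟨h1, i, j, h2⟩
    refine ⟨fun l => by rw [← iterate_succ_apply]; exact h1 _, i, j + 1, ?_⟩
    rw [← iterate_succ_apply, iterate_succ_apply', h2, ← iterate_succ_apply' f]
  have hstep : ∀ i, b (i + 1) = f (b i) := by
    intro i
    refine hsep _ (hAB (hbA _)) _ (hAB (hfA _ (hbA i))) ?_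
    have h1 := hbz (i + 1)
    have h2 := huc ((hbz i).trans_lt hrρ)
    rw [← iterate_succ_apply' f] at h2
    have h3 := dist_triangle_left (b (i + 1)) (f (b i)) (f^[i + 1 + 1] z)
    linarith
  have hbi : ∀ i, b i = f^[i] (b 0) := by
    intro i
    induction i with
    | zero => rfl
    | succ i ih => rw [hstep, ih, iterate_succ_apply']
  obtain ⟨j, hj⟩ : ∃ j, f^[j] z ∉ B := by
    by_contra! hcon
    have hz1 : f z = b 0 := by
      refine hsep _ (hcon 1) _ (hAB (hbA 0)) ?_
      have := hbz 0
      rw [zero_add] at this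
      exact this.trans_lt (by linarith)
    obtain ⟨-, i, l, hil⟩ := hbA 0
    have hzA : z ∈ A := ⟨hcon, i + 1, l, by rw [iterate_succ_apply, hz1, hil]⟩
    exact hzV (mem_biUnion hzA (Metric.mem_ball_self hr'))
  obtain ⟨-, t, u, htu⟩ := hbA 0
  refine ⟨_, hj, j * p - j + (u * p - u + (t + 1)), fun i => ?_⟩
  have e1 : f^[i] (f^[j * p - j + (u * p - u + (t + 1))] (f^[j] z)) =
      f^[(i + j * p + (u * p - u) + t) + 1] z := by
    simp only [← iterate_add_apply]
    congr 1
    have := Nat.le_mul_of_pos_right j hp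
    omega
  have e2 : f^[i] y = b (i + j * p + (u * p - u) + t) := by
    rw [hbi, iterate_add_apply, htu, ← iterate_add_apply, add_assoc,
      Nat.sub_add_cancel (Nat.le_mul_of_pos_right u hp), iterate_add_apply,
      iterate_mul_of_iterate_eq hy, iterate_add_apply, iterate_mul_of_iterate_eq hy]
  rw [e1, e2]
  exact (hbz _).trans hrr

end Escaping

section PeriodicAverages

variable {X E : Type*} [NormedAddCommGroup E]

theorem norm_birkhoffSum_le {f : X → X} {G : X → E} {C : ℝ} (hG : ∀ x, ‖G x‖ ≤ C) (n : ℕ)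
    (x : X) : ‖birkhoffSum f G n x‖ ≤ n * C := by
  refine (norm_sum_le_of_le _ fun i _ => hG _).trans ?_
  simp

theorem norm_birkhoffSum_sub_le {f : X → X} {G : X → E} {n : ℕ} {x y : X} {η : ℝ}
    (h : ∀ i < n, ‖G (f^[i] y) - G (f^[i] x)‖ ≤ η) :
    ‖birkhoffSum f G n y - birkhoffSum f G n x‖ ≤ n * η := by
  rw [birkhoffSum, birkhoffSum, ← Finset.sum_sub_distrib]
  refine (norm_sum_le_of_le _ fun i hi => h i (Finset.mem_range.1 hi)).trans ?_
  simp

theorem norm_birkhoffSum_sub_le_of_le {f : X → X} {G : X → E} {C : ℝ} (hC : 0 ≤ C)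
    (hG : ∀ x, ‖G x‖ ≤ C) {n m M : ℕ} (hnm : n ≤ m) (hmM : m ≤ n + M) {x y : X} {η : ℝ}
    (h : ∀ i < n, ‖G (f^[i] y) - G (f^[i] x)‖ ≤ η) :
    ‖birkhoffSum f G m y - birkhoffSum f G n x‖ ≤ n * η + M * C := by
  obtain ⟨k, rfl⟩ := Nat.exists_eq_add_of_le hnm
  rw [birkhoffSum_add, add_sub_right_comm]
  refine (norm_add_le _ _).trans (add_le_add (norm_birkhoffSum_sub_le h) ?_)
  refine (norm_birkhoffSum_le hG _ _).trans ?_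
  gcongr
  omega

theorem birkhoffSum_mul_of_iterate_eq {f : X → X} {G : X → E} {y : X} {p : ℕ}
    (hy : f^[p] y = y) (j : ℕ) :
    birkhoffSum f G (j * p) y = j • birkhoffSum f G p y := by
  induction j with
  | zero => simp
  | succ j ih =>
    rw [add_one_mul, birkhoffSum_add, ih, iterate_mul_of_iterate_eq hy, succ_nsmul]

variable [NormedSpace ℝ E]

/-- The averages of `G` along the periodic orbits of `f`. -/
def periodicAverages (f : X → X) (G : X → E) : Set E :=
  {v | ∃ y p, 0 < p ∧ f^[p] y = y ∧ v = birkhoffAverage ℝ f G p y}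

theorem birkhoffAverage_mul_of_iterate_eq {f : X → X} {G : X → E} {y : X} {p : ℕ}
    (hy : f^[p] y = y) {j : ℕ} (hj : 0 < j) :
    birkhoffAverage ℝ f G (j * p) y = birkhoffAverage ℝ f G p y := by
  have hj' : (j : ℝ) ≠ 0 := by positivity
  rw [birkhoffAverage, birkhoffAverage, birkhoffSum_mul_of_iterate_eq hy,
    ← Nat.cast_smul_eq_nsmul ℝ, smul_smul]
  congr 1
  push_cast
  rw [mul_inv, mul_right_comm, inv_mul_cancel₀ hj', one_mul]

theorem tendsto_birkhoffAverage_iterate_sub {f : X → X} {G : X → E}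
    (hG : Bornology.IsBounded (range G)) (x : X) (s : ℕ) :
    Tendsto (fun n => birkhoffAverage ℝ f G n (f^[s] x) - birkhoffAverage ℝ f G n x)
      atTop (𝓝 0) := by
  induction s with
  | zero => simp
  | succ s ih =>
    have := (tendsto_birkhoffAverage_apply_sub_birkhoffAverage' ℝ hG f (f^[s] x)).add ih
    simpa [iterate_succ_apply'] using this

theorem norm_inv_smul_sub_inv_smul_le {u v : E} {s t K : ℝ} (ht : 0 < t) (hts : t ≤ s)
    (hv : ‖v‖ ≤ t * K) :
    ‖s⁻¹ • u - t⁻¹ • v‖ ≤ (‖u - v‖ + (s - t) * K) / t := by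
  have hs : 0 < s := ht.trans_le hts
  have hK : 0 ≤ K := nonneg_of_mul_nonneg_right ((norm_nonneg v).trans hv) ht
  have e : s⁻¹ • u - t⁻¹ • v = s⁻¹ • ((u - v) - ((s - t) / t) • v) := by
    rw [smul_sub, smul_sub, smul_smul, sub_sub, ← add_smul]
    congr 2
    field_simp
    ring
  rw [e, norm_smul, norm_inv, Real.norm_of_nonneg hs.le, inv_mul_eq_div]
  have h1 : ‖(u - v) - ((s - t) / t) • v‖ ≤ ‖u - v‖ + (s - t) * K := by
    refine (norm_sub_le _ _).trans (add_le_add_right ?_ _)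
    rw [norm_smul, Real.norm_of_nonneg (div_nonneg (sub_nonneg.2 hts) ht.le)]
    calc (s - t) / t * ‖v‖ ≤ (s - t) / t * (t * K) := by
          gcongr
      _ = (s - t) * K := by field_simp
  have : 0 ≤ ‖u - v‖ + (s - t) * K :=
    add_nonneg (norm_nonneg _) (mul_nonneg (sub_nonneg.2 hts) hK)
  gcongr

/-- Closed sets stable under midpoints are convex. -/
theorem convex_of_isClosed_of_midpoint_mem {S : Set E} (hS : IsClosed S)
    (h : ∀ u ∈ S, ∀ v ∈ S, (2 : ℝ)⁻¹ • (u + v) ∈ S) : Convex ℝ S := by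
  rw [convex_iff_segment_subset]
  intro u hu v hv
  set γ : ℝ → E := ⇑(AffineMap.lineMap (k := ℝ) u v) with hγ
  have hγc : Continuous γ := AffineMap.lineMap_continuous
  rw [segment_eq_image_lineMap]
  rintro _ ⟨t, ht, rfl⟩
  by_contra htS
  have hcl : IsClosed (γ ⁻¹' S) := hS.preimage hγc
  obtain ⟨a, ⟨ha, haS⟩, hamax⟩ := ((isCompact_Icc (a := (0 : ℝ)) (b := t)).inter_right
    hcl).exists_isGreatest ⟨0, ⟨le_rfl, ht.1⟩, by simpa [hγ] using hu⟩
  obtain ⟨b, ⟨hb, hbS⟩, hbmin⟩ := ((isCompact_Icc (a := t) (b := (1 : ℝ))).inter_right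
    hcl).exists_isLeast ⟨1, ⟨ht.2, le_rfl⟩, by simpa [hγ] using hv⟩
  have hat : a < t := lt_of_le_of_ne ha.2 (by rintro rfl; exact htS haS)
  have htb : t < b := lt_of_le_of_ne hb.1 (by rintro rfl; exact htS hbS)
  have hmid : (a + b) / 2 ∈ γ ⁻¹' S := by
    have e : γ ((a + b) / 2) = (2 : ℝ)⁻¹ • (γ a + γ b) := by
      simp only [hγ, AffineMap.lineMap_apply_module]
      module
    rw [mem_preimage, e]
    exact h _ haS _ hbS
  rcases le_total ((a + b) / 2) t with hle | hle
  · have := hamax ⟨⟨by linarith [ha.1], hle⟩, hmid⟩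
    linarith
  · have := hbmin ⟨⟨hle, by linarith [hb.2]⟩, hmid⟩
    linarith

end PeriodicAverages

section InvariantMeasures

variable {X : Type*} [TopologicalSpace X] [CompactSpace X] [MeasurableSpace X] [BorelSpace X]

/-- For an invariant measure `μ` and `β < ∫ h dμ`, some point has all its Birkhoff averages of `h`
at least `β`. -/
theorem exists_forall_le_birkhoffSum {f : X → X} (hf : Continuous f) {h : X → ℝ}
    (hh : Continuous h) (μ : Measure X) [IsProbabilityMeasure μ] (hμ : μ.map f = μ) {β : ℝ}
    (hβ : β < ∫ x, h x ∂μ) : ∃ x, ∀ n : ℕ, n * β ≤ birkhoffSum f h n x := by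
  by_contra! hcon
  have hcont : ∀ n, Continuous (birkhoffSum f h n) := fun n =>
    continuous_finsetSum _ fun i _ => hh.comp (hf.iterate i)
  obtain ⟨I, hI⟩ := isCompact_univ.elim_finite_subcover
    (fun n : ℕ => {x | birkhoffSum f h n x < n * β})
    (fun n => isOpen_lt (hcont n) continuous_const)
    (fun x _ => mem_iUnion.2 (hcon x))
  obtain ⟨C, hC⟩ : ∃ C, ∀ x ∈ univ, ‖h x - β‖ ≤ C :=
    isCompact_univ.exists_bound_of_continuousOn (hh.sub continuous_const).continuousOn
  set N := I.sup id
  have hN : ∀ x, ∃ n ≤ N, birkhoffSum f h n x < n * β := by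
    intro x
    obtain ⟨n, hn, hx⟩ := mem_iUnion₂.1 (hI (mem_univ x))
    exact ⟨n, Finset.le_sup (f := id) hn, hx⟩
  have hX : Nonempty X := nonempty_of_isProbabilityMeasure μ
  have hC0 : 0 ≤ C := (norm_nonneg _).trans (hC hX.some (mem_univ _))
  have hle : ∀ T x, birkhoffSum f h T x ≤ T * β + N * C := by
    intro T
    induction T using Nat.strong_induction_on with
    | _ T ih =>
      intro x
      obtain ⟨n, hnN, hn⟩ := hN x
      rcases le_total T n with hTn | hnT
      · have h1 : birkhoffSum f h T x ≤ T * (β + C) := by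
          rw [birkhoffSum]
          refine (Finset.sum_le_card_nsmul _ _ (β + C) fun i _ => ?_).trans
            (le_of_eq (by simp [mul_add]))
          have := (le_abs_self _).trans (hC (f^[i] x) (mem_univ _))
          linarith
        have h2 : (T : ℝ) * C ≤ N * C := by
          gcongr
          exact hTn.trans hnN
        linarith
      · obtain ⟨k, rfl⟩ := Nat.exists_eq_add_of_le hnT
        have hn0 : n ≠ 0 := by
          rintro rfl
          simp at hn
        have := ih k (by omega) (f^[n] x)
        rw [birkhoffSum_add]
        push_cast
        linarith
  have hint : ∀ g : X → ℝ, Continuous g → Integrable g μ := fun g hg =>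
    hg.integrable_of_hasCompactSupport (HasCompactSupport.of_compactSpace g)
  have hmp : MeasurePreserving f μ μ := ⟨hf.measurable, hμ⟩
  have hintT : ∀ T, ∫ x, birkhoffSum f h T x ∂μ = T * ∫ x, h x ∂μ := by
    intro T
    simp only [birkhoffSum]
    rw [integral_finsetSum _ fun i _ => hint (fun x => h (f^[i] x)) (hh.comp (hf.iterate i))]
    have : ∀ i, ∫ x, h (f^[i] x) ∂μ = ∫ x, h x ∂μ := by
      intro i
      conv_rhs => rw [← (hmp.iterate i).map_eq]
      rw [integral_map (hf.iterate i).measurable.aemeasurable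
        hh.measurable.aestronglyMeasurable]
    simp [this]
  have hbound : ∀ T : ℕ, T * ∫ x, h x ∂μ ≤ T * β + N * C := by
    intro T
    rw [← hintT]
    refine (integral_mono (hint _ (hcont T)) (integrable_const (T * β + N * C)) (hle T)).trans ?_
    simp
  obtain ⟨T, hT⟩ := exists_nat_gt (N * C / (∫ x, h x ∂μ - β))
  rw [div_lt_iff₀ (sub_pos.2 hβ)] at hT
  have := hbound T
  linarith

end InvariantMeasures

section Density

variable {E : Type*} [NormedAddCommGroup E]

theorem exists_bound_of_continuous {X : Type*} [TopologicalSpace X] [CompactSpace X]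
    {G : X → E} (hG : Continuous G) : ∃ C, 0 ≤ C ∧ ∀ x, ‖G x‖ ≤ C := by
  obtain ⟨C, hC⟩ := isCompact_univ.exists_bound_of_continuousOn hG.continuousOn
  exact ⟨max C 0, le_max_right _ _, fun x => (hC x (mem_univ x)).trans (le_max_left _ _)⟩

theorem isBounded_range_of_continuous {X : Type*} [TopologicalSpace X] [CompactSpace X]
    {G : X → E} (hG : Continuous G) : Bornology.IsBounded (range G) :=
  (isCompact_range hG).isBounded

theorem exists_forall_norm_sub_le {X : Type*} [MetricSpace X] [CompactSpace X] {G : X → E}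
    (hG : Continuous G) {η : ℝ} (hη : 0 < η) :
    ∃ δ > 0, ∀ x y, dist x y ≤ δ → ‖G x - G y‖ ≤ η := by
  obtain ⟨δ, hδ, h⟩ := Metric.uniformContinuous_iff.1
    (CompactSpace.uniformContinuous_of_continuous hG) η hη
  refine ⟨δ / 2, half_pos hδ, fun x y hxy => ?_⟩
  rw [← dist_eq_norm]
  exact (h (hxy.trans_lt (half_lt_self hδ))).le

variable [NormedSpace ℝ E] {f : unitInterval → unitInterval} {x₀ c : unitInterval}
  {G : unitInterval → E}

/-- Averages over periodic orbits approximate the midpoint of the averages over long orbit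
segments of two given points. -/
theorem eventually_exists_periodicAverages_near (hf : Continuous f)
    (hx₀ : HasRecurringDenseOrbit f x₀) (hc : f c = c) (hG : Continuous G)
    {x₁ x₂ : unitInterval} (hx₁ : x₁ ∉ ({0, 1, c} : Set unitInterval))
    (hx₂ : x₂ ∉ ({0, 1, c} : Set unitInterval)) {η : ℝ} (hη : 0 < η) :
    ∀ᶠ n in atTop, ∃ v ∈ periodicAverages f G,
      ‖v - (2 : ℝ)⁻¹ • (birkhoffAverage ℝ f G n x₁ + birkhoffAverage ℝ f G n x₂)‖ ≤ η := by
  obtain ⟨C, hC, hGC⟩ := exists_bound_of_continuous hG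
  obtain ⟨δ, hδ, hGδ⟩ := exists_forall_norm_sub_le hG (half_pos hη)
  obtain ⟨M, N, h⟩ := exists_periodic_linking hf hx₀ hc hx₁ hx₂ hδ
  have hlim : ∀ᶠ n : ℕ in atTop, 2 * M * C / (n : ℝ) < η / 2 :=
    (tendsto_const_div_atTop_nhds_zero_nat (2 * M * C)).eventually_lt_const (half_pos hη)
  filter_upwards [eventually_ge_atTop N, eventually_gt_atTop 0, hlim] with n hnN hn hnM
  obtain ⟨y, m₁, m₂, hm₁, hm₁M, hm₂, hm₂M, hy, h₁, h₂⟩ := h n hnN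
  refine ⟨birkhoffAverage ℝ f G (m₁ + m₂) y, ⟨y, m₁ + m₂, by omega, hy, rfl⟩, ?_⟩
  have hn' : (0 : ℝ) < n := by exact_mod_cast hn
  have e₁ := norm_birkhoffSum_sub_le_of_le hC hGC hm₁ hm₁M fun i hi => hGδ _ _ (h₁ i hi)
  have e₂ := norm_birkhoffSum_sub_le_of_le hC hGC hm₂ hm₂M fun i hi => hGδ _ _ (h₂ i hi)
  set v := birkhoffSum f G n x₁ + birkhoffSum f G n x₂ with hv
  have e : ‖birkhoffSum f G (m₁ + m₂) y - v‖ ≤ n * η + 2 * M * C := by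
    rw [birkhoffSum_add, hv, add_sub_add_comm]
    refine (norm_add_le_of_le e₁ e₂).trans (le_of_eq ?_)
    ring
  have hvC : ‖v‖ ≤ 2 * n * C := by
    refine (norm_add_le_of_le (norm_birkhoffSum_le hGC _ _)
      (norm_birkhoffSum_le hGC _ _)).trans (le_of_eq ?_)
    ring
  have hm₁' : (n : ℝ) ≤ m₁ := by exact_mod_cast hm₁
  have hm₂' : (n : ℝ) ≤ m₂ := by exact_mod_cast hm₂
  have hm₁M' : (m₁ : ℝ) ≤ n + M := by exact_mod_cast hm₁M
  have hm₂M' : (m₂ : ℝ) ≤ n + M := by exact_mod_cast hm₂M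
  have key := norm_inv_smul_sub_inv_smul_le (u := birkhoffSum f G (m₁ + m₂) y) (v := v)
    (s := (m₁ : ℝ) + m₂) (t := 2 * n) (K := C) (by positivity) (by linarith) hvC
  have e' : (2 : ℝ)⁻¹ • (birkhoffAverage ℝ f G n x₁ + birkhoffAverage ℝ f G n x₂) =
      (2 * n : ℝ)⁻¹ • v := by
    rw [birkhoffAverage, birkhoffAverage, ← smul_add, smul_smul, ← mul_inv]
  rw [e', birkhoffAverage, Nat.cast_add]
  refine key.trans ?_
  have hs : ((m₁ : ℝ) + m₂ - 2 * n) * C ≤ 2 * M * C := by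
    gcongr
    linarith
  rw [div_lt_iff₀ hn'] at hnM
  rw [div_le_iff₀ (by positivity)]
  linarith

theorem midpoint_mem_closure_periodicAverages (hf : Continuous f)
    (hx₀ : HasRecurringDenseOrbit f x₀) (hc : f c = c) (hG : Continuous G) {u v : E}
    (hu : u ∈ periodicAverages f G) (hv : v ∈ periodicAverages f G) :
    (2 : ℝ)⁻¹ • (u + v) ∈ closure (periodicAverages f G) := by
  obtain ⟨y₁, p₁, hp₁, hy₁, rfl⟩ := hu
  obtain ⟨y₂, p₂, hp₂, hy₂, rfl⟩ := hv
  rw [Metric.mem_closure_iff]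
  intro ε hε
  have hη : 0 < ε / 4 := by positivity
  obtain ⟨δ, hδ, hGδ⟩ := exists_forall_norm_sub_le hG hη
  have hB : ({0, 1, c} : Set unitInterval).Finite := by simp
  have near : ∀ y p, 0 < p → f^[p] y = y → ∃ w ∉ ({0, 1, c} : Set unitInterval),
      ∀ᶠ n in atTop, ‖birkhoffAverage ℝ f G n w - birkhoffAverage ℝ f G n y‖ ≤ 2 * (ε / 4) := by
    intro y p hp hy
    obtain ⟨w, hwB, s, hw⟩ := exists_notMem_shadowing hf hx₀ hB hp hy hδ
    refine ⟨w, hwB, ?_⟩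
    have hlim := (tendsto_birkhoffAverage_iterate_sub (f := f)
      (isBounded_range_of_continuous hG) w s).norm
    rw [norm_zero] at hlim
    filter_upwards [hlim.eventually_lt_const hη, eventually_gt_atTop 0] with n hn hn0
    have hn' : (0 : ℝ) < n := by exact_mod_cast hn0
    have h1 : ‖birkhoffAverage ℝ f G n (f^[s] w) - birkhoffAverage ℝ f G n y‖ ≤ ε / 4 := by
      rw [birkhoffAverage, birkhoffAverage, ← smul_sub, norm_smul, norm_inv,
        Real.norm_of_nonneg hn'.le, inv_mul_le_iff₀ hn']
      exact norm_birkhoffSum_sub_le fun i _ => hGδ _ _ (hw i)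
    rw [norm_sub_rev] at hn
    have := norm_sub_le_norm_sub_add_norm_sub (birkhoffAverage ℝ f G n w)
      (birkhoffAverage ℝ f G n (f^[s] w)) (birkhoffAverage ℝ f G n y)
    linarith
  obtain ⟨w₁, hw₁, h₁⟩ := near y₁ p₁ hp₁ hy₁
  obtain ⟨w₂, hw₂, h₂⟩ := near y₂ p₂ hp₂ hy₂
  have hlink := eventually_exists_periodicAverages_near hf hx₀ hc hG hw₁ hw₂ hη
  have htend : Tendsto (fun j : ℕ => j * (p₁ * p₂)) atTop atTop :=
    tendsto_id.atTop_mul_const' (by positivity)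
  obtain ⟨j, hj, ⟨v, hv, hvn⟩, hj₁, hj₂⟩ := ((eventually_gt_atTop 0).and
    (htend.eventually (hlink.and (h₁.and h₂)))).exists
  refine ⟨v, hv, ?_⟩
  rw [show j * (p₁ * p₂) = (j * p₂) * p₁ by ring,
    birkhoffAverage_mul_of_iterate_eq hy₁ (by positivity)] at hj₁
  rw [← mul_assoc, birkhoffAverage_mul_of_iterate_eq hy₂ (by positivity), mul_assoc] at hj₂
  rw [show j * p₂ * p₁ = j * (p₁ * p₂) by ring] at hj₁
  set n := j * (p₁ * p₂)
  rw [dist_comm, dist_eq_norm]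
  set a := birkhoffAverage ℝ f G n w₁
  set b := birkhoffAverage ℝ f G n w₂
  have hmid : ‖(2 : ℝ)⁻¹ • (a + b) -
      (2 : ℝ)⁻¹ • (birkhoffAverage ℝ f G p₁ y₁ + birkhoffAverage ℝ f G p₂ y₂)‖ ≤ ε / 2 := by
    rw [← smul_sub, add_sub_add_comm, norm_smul]
    have := norm_add_le_of_le hj₁ hj₂
    norm_num
    linarith
  have := norm_sub_le_norm_sub_add_norm_sub v ((2 : ℝ)⁻¹ • (a + b))
    ((2 : ℝ)⁻¹ • (birkhoffAverage ℝ f G p₁ y₁ + birkhoffAverage ℝ f G p₂ y₂))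
  linarith

theorem convex_closure_periodicAverages (hf : Continuous f)
    (hx₀ : HasRecurringDenseOrbit f x₀) (hc : f c = c) (hG : Continuous G) :
    Convex ℝ (closure (periodicAverages f G)) := by
  refine convex_of_isClosed_of_midpoint_mem isClosed_closure fun u hu v hv => ?_
  have hcont : Continuous (Function.uncurry fun u v : E => (2 : ℝ)⁻¹ • (u + v)) := by
    unfold Function.uncurry
    fun_prop
  have := map_mem_closure₂ hcont hu hv fun a ha b hb =>
    midpoint_mem_closure_periodicAverages hf hx₀ hc hG ha hb
  rwa [closure_closure] at this

/-- The integral of a continuous function against an invariant measure is a limit of averages over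
periodic orbits. -/
theorem integral_mem_closure_periodicAverages [CompleteSpace E] (hf : Continuous f)
    (hx₀ : HasRecurringDenseOrbit f x₀) (hc : f c = c) (hG : Continuous G)
    (μ : Measure unitInterval) [IsProbabilityMeasure μ] (hμ : μ.map f = μ) :
    ∫ x, G x ∂μ ∈ closure (periodicAverages f G) := by
  by_contra hnot
  obtain ⟨ℓ, u₀, hlt, hgt⟩ := geometric_hahn_banach_closed_point
    (convex_closure_periodicAverages hf hx₀ hc hG) isClosed_closure hnot
  have hint : Integrable G μ := hG.integrable_of_hasCompactSupport
    (HasCompactSupport.of_compactSpace G)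
  rw [← ℓ.integral_comp_comm hint] at hgt
  obtain ⟨β, huβ, hβ⟩ := exists_between hgt
  obtain ⟨x, hx⟩ := exists_forall_le_birkhoffSum hf (ℓ.continuous.comp hG) μ hμ hβ
  have hxavg : ∀ n : ℕ, 0 < n → β ≤ ℓ (birkhoffAverage ℝ f G n x) := by
    intro n hn
    have hn' : (0 : ℝ) < n := by exact_mod_cast hn
    rw [birkhoffAverage, map_smul, birkhoffSum, map_sum, smul_eq_mul, le_inv_mul_iff₀ hn']
    exact hx n
  have hshift : ∀ s, Tendsto (fun n => ℓ (birkhoffAverage ℝ f G n (f^[s] x)) -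
      ℓ (birkhoffAverage ℝ f G n x)) atTop (𝓝 0) := by
    intro s
    have := (ℓ.continuous.tendsto 0).comp (tendsto_birkhoffAverage_iterate_sub (f := f)
      (isBounded_range_of_continuous hG) x s)
    simpa [Function.comp_def] using this
  have hη : 0 < (β - u₀) / 2 := by linarith
  by_cases hB : ∃ s, f^[s] x ∉ ({0, 1, c} : Set unitInterval)
  · obtain ⟨s, hs⟩ := hB
    have hη' : 0 < (β - u₀) / 2 / (‖ℓ‖ + 1) := by positivity
    have hlink := eventually_exists_periodicAverages_near hf hx₀ hc hG hs hs hη'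
    obtain ⟨n, hn, ⟨v, hv, hvn⟩, hn0⟩ := (((hshift s).eventually_const_lt
      (neg_lt_zero.2 hη)).and (hlink.and (eventually_gt_atTop 0))).exists
    have h1 := hlt v (subset_closure hv)
    have h2 := hxavg n hn0
    rw [← two_smul ℝ, smul_smul, inv_mul_cancel₀ two_ne_zero, one_smul] at hvn
    have h3 : |ℓ (v - birkhoffAverage ℝ f G n (f^[s] x))| ≤ (β - u₀) / 2 := by
      refine (ℓ.le_opNorm _).trans ?_
      rw [le_div_iff₀ (by positivity)] at hvn
      nlinarith [norm_nonneg (v - birkhoffAverage ℝ f G n (f^[s] x)), norm_nonneg ℓ]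
    rw [map_sub] at h3
    have := neg_le_of_abs_le h3
    linarith
  · push Not at hB
    obtain ⟨a, b, hab, heq⟩ := Set.Finite.exists_lt_map_eq_of_forall_mem hB (by simp)
    have hper : f^[b - a] (f^[a] x) = f^[a] x := by
      rw [← iterate_add_apply, Nat.sub_add_cancel hab.le, heq]
    have hp : 0 < b - a := Nat.sub_pos_of_lt hab
    have h1 := hlt _ (subset_closure ⟨f^[a] x, b - a, hp, hper, rfl⟩)
    have htend : Tendsto (fun j : ℕ => j * (b - a)) atTop atTop :=
      tendsto_id.atTop_mul_const' hp
    obtain ⟨j, hj, hj0⟩ := ((htend.eventually ((hshift a).eventually_const_lt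
      (neg_lt_zero.2 hη))).and (eventually_gt_atTop 0)).exists
    rw [birkhoffAverage_mul_of_iterate_eq hper hj0] at hj
    have h2 := hxavg (j * (b - a)) (by positivity)
    linarith

theorem exists_fixedPt (hf : Continuous f) : ∃ c, f c = c := by
  obtain ⟨c, -, hc⟩ := isPreconnected_univ.intermediate_value₂ (mem_univ (1 : unitInterval))
    (mem_univ (0 : unitInterval)) hf.continuousOn continuousOn_id
    unitInterval.le_one' unitInterval.nonneg'
  exact ⟨c, hc⟩

end Density

section WeakStar

variable {X : Type*} [MetricSpace X] [MeasurableSpace X] [BorelSpace X]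

theorem integral_periodicOrbitMeasure (f : X → X) (y : X) {p : ℕ} (hp : 0 < p) {g : X → ℝ}
    (hg : Continuous g) :
    ∫ x, g x ∂(periodicOrbitMeasure f y p : Measure X) = birkhoffAverage ℝ f g p y := by
  have hmax : max p 1 = p := max_eq_left hp
  simp only [periodicOrbitMeasure, avgDirac, ProbabilityMeasure.coe_mk, hmax]
  rw [integral_smul_measure, integral_finsetSum_measure]
  · simp only [integral_dirac' _ _ hg.stronglyMeasurable]
    simp [birkhoffAverage, birkhoffSum]
  · intro i _
    exact integrable_dirac (by simp)

/-- A set of probability measures accumulates at `μ` as soon as it does so after testing against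
any finite family of bounded continuous functions. -/
theorem ProbabilityMeasure.mem_closure_of_forall_finite {S : Set (ProbabilityMeasure X)}
    {μ : ProbabilityMeasure X}
    (h : ∀ I : Set (BoundedContinuousFunction X ℝ), I.Finite →
      (fun g : I => ∫ x, (g : X → ℝ) x ∂(μ : Measure X)) ∈
        closure ((fun (ν : ProbabilityMeasure X) (g : I) => ∫ x, (g : X → ℝ) x ∂(ν : Measure X)) ''
          S)) :
    μ ∈ closure S := by
  set Φ : ProbabilityMeasure X → BoundedContinuousFunction X ℝ → ℝ :=
    fun ν g => ∫ x, g x ∂(ν : Measure X) with hΦ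
  have hle : comap Φ (𝓝 (Φ μ)) ≤ 𝓝 μ := by
    have : Tendsto (id : ProbabilityMeasure X → _) (comap Φ (𝓝 (Φ μ))) (𝓝 μ) := by
      rw [ProbabilityMeasure.tendsto_iff_forall_integral_tendsto]
      exact fun g => tendsto_pi_nhds.1 (tendsto_comap (f := Φ) (x := 𝓝 (Φ μ))) g
    exact this
  rw [mem_closure_iff_nhds]
  intro U hU
  obtain ⟨V, hV, hVU⟩ := mem_comap.1 (hle hU)
  rw [nhds_pi, Filter.mem_pi] at hV
  obtain ⟨I, hI, t, ht, htV⟩ := hV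
  have hW : univ.pi (fun g : I => t g) ∈
      𝓝 (fun g : I => ∫ x, (g : X → ℝ) x ∂(μ : Measure X)) := by
    have := hI.to_subtype
    exact set_pi_mem_nhds finite_univ fun g _ => ht g
  obtain ⟨_, hνt, ν, hνS, rfl⟩ := mem_closure_iff_nhds.1 (h I hI) _ hW
  exact ⟨ν, hVU (htV fun g hg => hνt ⟨g, hg⟩ (mem_univ _)), hνS⟩

theorem subset_closure_perMeasures {f : unitInterval → unitInterval} (hf : Continuous f)
    (htrans : ∃ x, Dense (range fun n : ℕ => f^[n] x)) :
    {μ : ProbabilityMeasure unitInterval | μ.toMeasure.map f = μ.toMeasure} ⊆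
      closure (perMeasures f univ) := by
  intro μ hμ
  obtain ⟨x₀, hx₀⟩ := htrans
  obtain ⟨c, hc⟩ := exists_fixedPt hf
  refine ProbabilityMeasure.mem_closure_of_forall_finite fun I hI => ?_
  have := hI.fintype
  set G : unitInterval → I → ℝ := fun x g => (g : unitInterval → ℝ) x with hGdef
  have hG : Continuous G := continuous_pi fun g => g.1.continuous
  have key := integral_mem_closure_periodicAverages hf (hasRecurringDenseOrbit_of_dense hx₀) hc hG
    (μ : Measure unitInterval) hμ
  have hint : ∫ x, G x ∂(μ : Measure unitInterval) =
      fun g : I => ∫ x, (g : unitInterval → ℝ) x ∂(μ : Measure unitInterval) := by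
    ext g
    exact eval_integral (fun g : I => g.1.integrable _) g
  rw [hint] at key
  refine closure_mono ?_ key
  rintro _ ⟨y, p, hp, hy, rfl⟩
  refine ⟨periodicOrbitMeasure f y p, ⟨y, mem_univ y, p, hp, hy, rfl⟩, ?_⟩
  ext g
  simp only [integral_periodicOrbitMeasure f y hp g.1.continuous]
  simp [birkhoffAverage, birkhoffSum, hGdef]

end WeakStar

end IntervalDynamics

theorem stmt13 (f : Set.Icc (0 : ℝ) 1 → Set.Icc (0 : ℝ) 1) (hf : Continuous f)
    (htrans : ∃ x : Set.Icc (0 : ℝ) 1, Dense (Set.range fun n : ℕ => f^[n] x)) :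
    {μ : ProbabilityMeasure (Set.Icc (0 : ℝ) 1) | μ.toMeasure.map f = μ.toMeasure}
      ⊆ closure (perMeasures f Set.univ) := by
  exact IntervalDynamics.subset_closure_perMeasures hf htrans
end

section
/- Let X be a compact metric space and {x_i}, {y_i} sequences in X such that V({x_i}) is a singleton. Then V({x_i}) = V({y_i}) if and only if lim_{n→∞} min_{σ∈S_n} (1/n) Σ_{i=0}^{n-1} d(x_i, y_{σ(i)}) = 0. -/
open MeasureTheory Filter Topology
open scoped ENNReal NNReal

theorem exists_perm_card_not_le {α : Type*} [Fintype α] [DecidableEq α] (r : α → α → Prop)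
    [DecidableRel r] (k : ℕ)
    (h : ∀ S : Finset α, S.card ≤ (Finset.univ.filter fun j => ∃ i ∈ S, r i j).card + k) :
    ∃ σ : Equiv.Perm α, (Finset.univ.filter fun i => ¬ r i (σ i)).card ≤ k := by
  let t : α → Finset (α ⊕ Fin k) := fun i => (Finset.univ.filter (r i)).disjSum Finset.univ
  have hall : ∀ S : Finset α, S.card ≤ (S.biUnion t).card := by
    intro S
    rcases S.eq_empty_or_nonempty with rfl | ⟨i₀, hi₀⟩
    · simp
    · have hsub : (Finset.univ.filter fun j => ∃ i ∈ S, r i j).disjSum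
          (Finset.univ : Finset (Fin k)) ⊆ S.biUnion t := by
        rintro (j | j) hj
        · simpa [t] using hj
        · simpa [t] using ⟨i₀, hi₀⟩
      simpa [Finset.card_disjSum] using (h S).trans
        (by simpa [Finset.card_disjSum] using Finset.card_le_card hsub)
  obtain ⟨f, hf, hft⟩ := (Finset.all_card_le_biUnion_card_iff_exists_injective t).1 hall
  let g : α → α := fun i => (f i).elim id fun _ => i
  let s : Finset α := Finset.univ.filter fun i => (f i).isLeft
  have hs : ∀ i ∈ s, f i = Sum.inl (g i) := by
    intro i hi
    simp only [s, Finset.mem_filter, Finset.mem_univ, true_and] at hi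
    obtain ⟨a, ha⟩ := Sum.isLeft_iff.1 hi
    simp [g, ha]
  have hg : Set.InjOn g s := by
    intro a ha b hb hab
    apply hf
    rw [hs a ha, hs b hb, hab]
  obtain ⟨e, he⟩ := Finset.exists_equiv_extend_of_card_eq (α := α) (t := (Finset.univ : Finset α))
    (by simp) (Finset.subset_univ (s.image g)) hg
  refine ⟨e.trans (Equiv.subtypeUnivEquiv fun _ => Finset.mem_univ _), ?_⟩
  have hbad : ∀ i, ¬ r i (e i) → ∃ b, f i = Sum.inr b := by
    intro i hi
    rcases hfi : f i with a | b
    · have his : i ∈ s := by simp [s, hfi]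
      have h1 := hft i
      rw [hs i his, ← he i his] at h1
      exact absurd (by simpa [t] using h1) hi
    · exact ⟨b, rfl⟩
  have hle := Finset.card_le_card_of_injOn (s := Finset.univ.filter fun i => ¬ r i (e i))
    (t := (Finset.univ : Finset (Fin k)).map Function.Embedding.inr) f
    (by
      intro i hi
      obtain ⟨b, hb⟩ := hbad i (by simpa using hi)
      simp [hb]) hf.injOn
  simpa using hle

theorem avgDirac_toMeasure {X : Type*} [MetricSpace X] [MeasurableSpace X] [BorelSpace X]
    (x : ℕ → X) {n : ℕ} (hn : 0 < n) :
    (avgDirac x n : Measure X) = (n : ℝ≥0∞)⁻¹ • ∑ i : Fin n, Measure.dirac (x i) := by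
  change ((max n 1 : ℕ) : ℝ≥0∞)⁻¹ • ∑ i ∈ Finset.range (max n 1), Measure.dirac (x i) = _
  rw [max_eq_left hn, Finset.sum_range]

theorem integral_avgDirac {X : Type*} [MetricSpace X] [MeasurableSpace X] [BorelSpace X]
    (x : ℕ → X) {n : ℕ} (hn : 0 < n) (f : X → ℝ) :
    ∫ z, f z ∂(avgDirac x n : Measure X) = (∑ i : Fin n, f (x i)) / n := by
  rw [avgDirac_toMeasure x hn, integral_smul_measure,
    integral_finsetSum_measure fun i _ => integrable_dirac (by simp)]
  simp [div_eq_inv_mul]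

theorem avgDirac_apply {X : Type*} [MetricSpace X] [MeasurableSpace X] [BorelSpace X]
    (x : ℕ → X) {n : ℕ} (hn : 0 < n) {A : Set X} (hA : MeasurableSet A)
    [DecidablePred fun i : Fin n => x i ∈ A] :
    (avgDirac x n : Measure X) A =
      (n : ℝ≥0∞)⁻¹ * ((Finset.univ.filter fun i : Fin n => x i ∈ A).card : ℝ≥0∞) := by
  rw [avgDirac_toMeasure x hn, Measure.smul_apply, Measure.finsetSum_apply, smul_eq_mul]
  congr 1
  simp [Measure.dirac_apply' _ hA, Set.indicator_apply, Finset.sum_boole]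

theorem exists_perm_sum_dist_le {X : Type*} [MetricSpace X] [CompactSpace X]
    [MeasurableSpace X] [BorelSpace X] (x y : ℕ → X) {n : ℕ} (hn : 0 < n) {ε : ℝ} (hε : 0 < ε)
    (h : levyProkhorovEDist (avgDirac x n : Measure X) (avgDirac y n) < ENNReal.ofReal ε) :
    ∃ σ : Equiv.Perm (Fin n),
      (∑ i : Fin n, dist (x i) (y (σ i))) / n ≤ ε * (1 + Metric.diam (Set.univ : Set X)) := by
  classical
  have hn' : (0 : ℝ) < n := by exact_mod_cast hn
  obtain ⟨σ, hσ⟩ := exists_perm_card_not_le (fun i j : Fin n => dist (x i) (y j) < ε) ⌊n * ε⌋₊ (by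
    intro S
    let B : Set X := (fun i : Fin n => x i) '' S
    have hB : MeasurableSet B := (S.finite_toSet.image _).measurableSet
    have h1 := left_measure_le_of_levyProkhorovEDist_lt h hB
    rw [avgDirac_apply x hn hB, avgDirac_apply y hn Metric.isOpen_thickening.measurableSet,
      ENNReal.toReal_ofReal hε.le] at h1
    have h2 : S.card ≤ (Finset.univ.filter fun i : Fin n => x i ∈ B).card :=
      Finset.card_le_card fun i hi => by
        simpa using! Set.mem_image_of_mem (fun i : Fin n => x i) hi
    have h3 : (Finset.univ.filter fun j : Fin n => y j ∈ Metric.thickening ε B) =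
        Finset.univ.filter fun j : Fin n => ∃ i ∈ S, dist (x i) (y j) < ε := by
      ext j
      simp [B, Metric.mem_thickening_iff, dist_comm]
    rw [h3] at h1
    set N := (Finset.univ.filter fun j : Fin n => ∃ i ∈ S, dist (x i) (y j) < ε).card
    have h4 := ENNReal.toReal_mono (by finiteness) h1
    rw [ENNReal.toReal_add (by finiteness) (by finiteness)] at h4
    simp only [ENNReal.toReal_mul, ENNReal.toReal_inv, ENNReal.toReal_natCast,
      ENNReal.toReal_ofReal hε.le] at h4
    have h5 : (S.card : ℝ) ≤ N + n * ε := by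
      have h6 := mul_le_mul_of_nonneg_left h4 hn'.le
      rw [mul_add, mul_inv_cancel_left₀ hn'.ne', mul_inv_cancel_left₀ hn'.ne'] at h6
      exact le_trans (by exact_mod_cast h2) h6
    have h7 : S.card - N ≤ ⌊n * ε⌋₊ := by
      rcases le_total S.card N with hle | hle
      · simp [Nat.sub_eq_zero_of_le hle]
      · apply Nat.le_floor
        push_cast [Nat.cast_sub hle]
        linarith
    have h8 : S.card ≤ N + ⌊n * ε⌋₊ := by lia
    convert h8)
  refine ⟨σ, ?_⟩
  have hD : 0 ≤ Metric.diam (Set.univ : Set X) := Metric.diam_nonneg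
  have hpt : ∀ i : Fin n, dist (x i) (y (σ i)) ≤
      ε + if ¬ dist (x i) (y (σ i)) < ε then Metric.diam (Set.univ : Set X) else 0 := by
    intro i
    by_cases hi : dist (x i) (y (σ i)) < ε
    · simpa [hi] using hi.le
    · rw [if_pos hi]
      have := Metric.dist_le_diam_of_mem (isCompact_univ (X := X)).isBounded
        (Set.mem_univ (x i)) (Set.mem_univ (y (σ i)))
      linarith
  have hbad : ((Finset.univ.filter fun i : Fin n => ¬ dist (x i) (y (σ i)) < ε).card : ℝ)
      ≤ n * ε :=
    (Nat.cast_le.2 hσ).trans (Nat.floor_le (by positivity))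
  rw [div_le_iff₀ hn']
  calc ∑ i : Fin n, dist (x i) (y (σ i))
      ≤ _ := Finset.sum_le_sum fun i _ => hpt i
    _ = n * ε + (Finset.univ.filter fun i : Fin n => ¬ dist (x i) (y (σ i)) < ε).card *
          Metric.diam (Set.univ : Set X) := by
        rw [Finset.sum_add_distrib, ← Finset.sum_filter]
        simp
    _ ≤ n * ε + n * ε * Metric.diam (Set.univ : Set X) := by gcongr
    _ = _ := by ring

theorem limitMeasures_eq_singleton_iff {X : Type*} [MetricSpace X] [CompactSpace X]
    [MeasurableSpace X] [BorelSpace X] (x : ℕ → X) (μ : ProbabilityMeasure X) :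
    limitMeasures x = {μ} ↔ Tendsto (avgDirac x) atTop (𝓝 μ) := by
  constructor
  · intro h
    refine tendsto_nhds_of_unique_mapClusterPt fun ν hν => ?_
    have hmem : ν ∈ limitMeasures x := hν.tendsto_subseq
    simpa [h] using hmem
  · intro h
    ext ν
    constructor
    · rintro ⟨φ, hφ, hν⟩
      exact tendsto_nhds_unique hν (h.comp hφ.tendsto_atTop)
    · rintro rfl
      exact ⟨id, strictMono_id, h⟩

theorem tendsto_iInf_perm_of_tendsto_avgDirac {X : Type*} [MetricSpace X] [CompactSpace X]
    [MeasurableSpace X] [BorelSpace X] (x y : ℕ → X) (μ : ProbabilityMeasure X)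
    (hx : Tendsto (avgDirac x) atTop (𝓝 μ)) (hy : Tendsto (avgDirac y) atTop (𝓝 μ)) :
    Tendsto (fun n => ⨅ σ : Equiv.Perm (Fin n),
        (∑ i : Fin n, dist (x (i : ℕ)) (y ((σ i : Fin n) : ℕ))) / n) atTop (𝓝 0) := by
  have hc := LevyProkhorov.continuous_ofMeasure_probabilityMeasure (Ω := X)
  have hd := ((hc.tendsto μ).comp hx).edist ((hc.tendsto μ).comp hy)
  rw [edist_self] at hd
  have hD : 0 < 1 + Metric.diam (Set.univ : Set X) :=
    add_pos_of_pos_of_nonneg one_pos Metric.diam_nonneg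
  refine Metric.tendsto_nhds.2 fun δ hδ => ?_
  have hε : 0 < δ / 2 / (1 + Metric.diam (Set.univ : Set X)) := by positivity
  filter_upwards [hd.eventually_lt_const (ENNReal.ofReal_pos.2 hε), eventually_gt_atTop 0]
    with n hn hn0
  obtain ⟨σ, hσ⟩ := exists_perm_sum_dist_le x y hn0 hε hn
  rw [div_mul_cancel₀ _ hD.ne'] at hσ
  rw [Real.dist_0_eq_abs, abs_of_nonneg (Real.iInf_nonneg fun σ => by positivity)]
  have := ciInf_le (Set.finite_range fun σ : Equiv.Perm (Fin n) =>
    (∑ i : Fin n, dist (x (i : ℕ)) (y ((σ i : Fin n) : ℕ))) / n).bddBelow σ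
  linarith

theorem tendsto_avgDirac_of_tendsto_iInf_perm {X : Type*} [MetricSpace X]
    [MeasurableSpace X] [BorelSpace X] (x y : ℕ → X) (μ : ProbabilityMeasure X)
    (hx : Tendsto (avgDirac x) atTop (𝓝 μ))
    (h : Tendsto (fun n => ⨅ σ : Equiv.Perm (Fin n),
        (∑ i : Fin n, dist (x (i : ℕ)) (y ((σ i : Fin n) : ℕ))) / n) atTop (𝓝 0)) :
    Tendsto (avgDirac y) atTop (𝓝 μ) := by
  rw [tendsto_iff_forall_lipschitz_integral_tendsto] at hx ⊢
  rintro f hb ⟨L, hL⟩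
  refine (hx f hb ⟨L, hL⟩).congr_dist (squeeze_zero' (.of_forall fun _ => dist_nonneg) ?_
    (by simpa using h.const_mul (L : ℝ)))
  filter_upwards [eventually_gt_atTop 0] with n hn
  obtain ⟨σ, hσ⟩ := exists_eq_ciInf_of_finite (f := fun σ : Equiv.Perm (Fin n) =>
    (∑ i : Fin n, dist (x (i : ℕ)) (y ((σ i : Fin n) : ℕ))) / n)
  rw [← hσ, integral_avgDirac x hn, integral_avgDirac y hn,
    ← Equiv.sum_comp σ fun i : Fin n => f (y i), Real.dist_eq, ← sub_div,
    ← Finset.sum_sub_distrib, abs_div, Nat.abs_cast, ← mul_div_assoc, Finset.mul_sum]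
  gcongr
  exact (Finset.abs_sum_le_sum_abs _ _).trans
    (Finset.sum_le_sum fun i _ => hL.dist_le_mul _ _)

theorem stmt15 {X : Type*} [MetricSpace X] [CompactSpace X]
    [MeasurableSpace X] [BorelSpace X]
    (x y : ℕ → X) (μ : ProbabilityMeasure X) (hx : limitMeasures x = {μ}) :
    limitMeasures x = limitMeasures y ↔
      Tendsto (fun n => ⨅ σ : Equiv.Perm (Fin n),
        (∑ i : Fin n, dist (x (i : ℕ)) (y ((σ i : Fin n) : ℕ))) / n) atTop (𝓝 0) := by
  rw [hx, eq_comm, limitMeasures_eq_singleton_iff]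
  rw [limitMeasures_eq_singleton_iff] at hx
  exact ⟨tendsto_iInf_perm_of_tendsto_avgDirac x y μ hx,
    tendsto_avgDirac_of_tendsto_iInf_perm x y μ hx⟩
end
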